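/- arXiv:1801.03071 — 2 statements merged into one kernel-verified Lean document; each statement's English description precedes it below -/
import Mathlib

section
/- Saturation of the tripartite monogamy bound by the GHZ state: Let |GHZ⟩ = (|000⟩ + |111⟩)/√2 and let ρ = |GHZ⟩⟨GHZ| ⊗ |0⟩⟨0| be the 4-qubit density matrix with qubits 1,2,3 in the GHZ state and qubit 4 in the state |0⟩. Then 𝒯²₁₂₃(ρ) = 4, and consequently ρ attains equality in the monogamy relation 𝒯²₁₂₃ + 𝒯²₁₂₄ ≤ 4 (since 𝒯²₁₂₄(ρ) = 0). -/
open Matrix Complex ComplexOrder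

noncomputable section

/-- The Pauli X matrix. -/
def pX : Matrix (Fin 2) (Fin 2) ℂ := !![0, 1; 1, 0]

/-- The Pauli Y matrix. -/
def pY : Matrix (Fin 2) (Fin 2) ℂ := !![0, -Complex.I; Complex.I, 0]

/-- The Pauli Z matrix. -/
def pZ : Matrix (Fin 2) (Fin 2) ℂ := !![1, 0; 0, -1]

/-- The operator on `n` qubits acting as the single-qubit operator `M` on qubit `i`
and as the identity on all other qubits. -/
def onQubit {n : ℕ} (M : Matrix (Fin 2) (Fin 2) ℂ) (i : Fin n) :
    Matrix (Fin n → Fin 2) (Fin n → Fin 2) ℂ :=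
  Matrix.of fun a b => ∏ s, if s = i then M (a s) (b s) else (if a s = b s then 1 else 0)

/-- An `n`-qubit density matrix: positive semidefinite with unit trace. -/
def IsDensityMatrix {n : ℕ} (ρ : Matrix (Fin n → Fin 2) (Fin n → Fin 2) ℂ) : Prop :=
  ρ.PosSemidef ∧ ρ.trace = 1

/-- The two Pauli matrices spanning the xy plane. -/
def XY : Fin 2 → Matrix (Fin 2) (Fin 2) ℂ := ![pX, pY]

/-- The two Pauli matrices spanning the xz plane. -/
def XZ : Fin 2 → Matrix (Fin 2) (Fin 2) ℂ := ![pX, pZ]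

/-- The xy-plane Bell strength 𝒯²_{ij}(ρ) of the pair of qubits (i,j). -/
def T2pair {n : ℕ} (ρ : Matrix (Fin n → Fin 2) (Fin n → Fin 2) ℂ) (i j : Fin n) : ℝ :=
  ∑ k : Fin 2, ∑ l : Fin 2,
    ((ρ * (onQubit (XY k) i * onQubit (XY l) j)).trace.re) ^ 2

/-- The xy-plane Bell strength 𝒯²_{ijm}(ρ) of the triple of qubits (i,j,m). -/
def T2triple {n : ℕ} (ρ : Matrix (Fin n → Fin 2) (Fin n → Fin 2) ℂ) (i j m : Fin n) : ℝ :=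
  ∑ k : Fin 2, ∑ l : Fin 2, ∑ p : Fin 2,
    ((ρ * (onQubit (XY k) i * onQubit (XY l) j * onQubit (XY p) m)).trace.re) ^ 2

/-- The xy-plane Bell strength 𝒯²_{ijml}(ρ) of the quadruple of qubits (i,j,m,l). -/
def T2quad {n : ℕ} (ρ : Matrix (Fin n → Fin 2) (Fin n → Fin 2) ℂ) (i j m l : Fin n) : ℝ :=
  ∑ k : Fin 2, ∑ k' : Fin 2, ∑ k'' : Fin 2, ∑ k''' : Fin 2,
    ((ρ * (onQubit (XY k) i * onQubit (XY k') j * onQubit (XY k'') m *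
        onQubit (XY k''') l)).trace.re) ^ 2

/-- The xz-plane Bell strength of the pair of qubits (i,j). -/
def T2pairXZ {n : ℕ} (ρ : Matrix (Fin n → Fin 2) (Fin n → Fin 2) ℂ) (i j : Fin n) : ℝ :=
  ∑ k : Fin 2, ∑ l : Fin 2,
    ((ρ * (onQubit (XZ k) i * onQubit (XZ l) j)).trace.re) ^ 2

/-- The 4-qubit vector |GHZ⟩ ⊗ |0⟩, with |GHZ⟩ = (|000⟩ + |111⟩)/√2 on qubits 1,2,3
and |0⟩ on qubit 4. -/
def ghzZeroVec : (Fin 4 → Fin 2) → ℂ := fun a =>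
  if a 0 = a 1 ∧ a 1 = a 2 ∧ a 3 = 0 then ((Real.sqrt 2 : ℂ))⁻¹ else 0

/-- The 4-qubit density matrix |GHZ⟩⟨GHZ| ⊗ |0⟩⟨0|. -/
def ghzZeroRho : Matrix (Fin 4 → Fin 2) (Fin 4 → Fin 2) ℂ :=
  Matrix.of fun a b => ghzZeroVec a * (starRingEnd ℂ) (ghzZeroVec b)

/-- The tensor product of single-qubit operators. -/
def tensorOp {n : ℕ} (M : Fin n → Matrix (Fin 2) (Fin 2) ℂ) :
    Matrix (Fin n → Fin 2) (Fin n → Fin 2) ℂ :=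
  Matrix.of fun a b => ∏ s, M s (a s) (b s)

lemma onQubit_eq_tensorOp {n : ℕ} (M : Matrix (Fin 2) (Fin 2) ℂ) (i : Fin n) :
    onQubit M i = tensorOp (fun s => if s = i then M else 1) := by
  ext a b
  simp only [onQubit, tensorOp, Matrix.of_apply]
  refine Finset.prod_congr rfl fun s _ => ?_
  split_ifs <;> simp_all [Matrix.one_apply]

lemma tensorOp_mul {n : ℕ} (M N : Fin n → Matrix (Fin 2) (Fin 2) ℂ) :
    tensorOp M * tensorOp N = tensorOp (fun s => M s * N s) := by
  ext a b
  simp only [tensorOp, Matrix.mul_apply, Matrix.of_apply, Fintype.prod_sum,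
    Finset.prod_mul_distrib]

lemma ghzZeroVec_eq :
    ghzZeroVec =
      ((Real.sqrt 2 : ℂ))⁻¹ •
        (Pi.single ![0, 0, 0, 0] 1 + Pi.single ![1, 1, 1, 0] 1 : (Fin 4 → Fin 2) → ℂ) := by
  ext a
  have hz : a = ![0, 0, 0, 0] ↔ a 0 = 0 ∧ a 1 = 0 ∧ a 2 = 0 ∧ a 3 = 0 := by
    simp [funext_iff, Fin.forall_fin_succ]
  have ho : a = ![1, 1, 1, 0] ↔ a 0 = 1 ∧ a 1 = 1 ∧ a 2 = 1 ∧ a 3 = 0 := by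
    simp [funext_iff, Fin.forall_fin_succ]
  simp only [ghzZeroVec, Pi.smul_apply, Pi.add_apply, Pi.single_apply, hz, ho, smul_eq_mul]
  generalize a 0 = p, a 1 = q, a 2 = r, a 3 = t
  fin_cases p <;> fin_cases q <;> fin_cases r <;> fin_cases t <;> simp

lemma trace_ghzZeroRho_mul_tensorOp (M : Fin 4 → Matrix (Fin 2) (Fin 2) ℂ) :
    (ghzZeroRho * tensorOp M).trace =
      1 / 2 * M 3 0 0 * ∑ x, ∑ y, M 0 x y * M 1 x y * M 2 x y := by
  have hρ : ghzZeroRho = vecMulVec ghzZeroVec (star ghzZeroVec) := rfl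
  have hc : ((Real.sqrt 2 : ℂ))⁻¹ * ((Real.sqrt 2 : ℂ))⁻¹ = 1 / 2 := by
    rw [← mul_inv, ← Complex.ofReal_mul, Real.mul_self_sqrt (by norm_num)]
    norm_num
  rw [hρ, Matrix.vecMulVec_mul, Matrix.trace_vecMulVec, dotProduct_comm,
    ← Matrix.dotProduct_mulVec, ghzZeroVec_eq]
  simp only [star_smul, star_add, Pi.star_single, star_one, Matrix.mulVec_smul,
    Matrix.mulVec_add, smul_dotProduct, dotProduct_smul, add_dotProduct,
    Matrix.mulVec_single_one, single_one_dotProduct, Pi.add_apply, Matrix.col_apply,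
    tensorOp, Matrix.of_apply, Fin.prod_univ_four, Fin.sum_univ_two, smul_eq_mul]
  rw [show star ((Real.sqrt 2 : ℂ))⁻¹ = ((Real.sqrt 2 : ℂ))⁻¹ by simp, ← mul_assoc, hc]
  simp
  ring

/-- **Saturation of the tripartite monogamy bound by the GHZ state.** For
ρ = |GHZ⟩⟨GHZ| ⊗ |0⟩⟨0| one has 𝒯²₁₂₃(ρ) = 4 and 𝒯²₁₂₄(ρ) = 0, so ρ attains equality in
the monogamy relation 𝒯²₁₂₃ + 𝒯²₁₂₄ ≤ 4. -/
theorem ghz_saturates_tripartite_monogamy :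
    T2triple ghzZeroRho 0 1 2 = 4 ∧ T2triple ghzZeroRho 0 1 3 = 0 ∧
    T2triple ghzZeroRho 0 1 2 + T2triple ghzZeroRho 0 1 3 = 4 := by
  have h₁ : T2triple ghzZeroRho 0 1 2 = 4 := by
    simp only [T2triple, onQubit_eq_tensorOp, tensorOp_mul, trace_ghzZeroRho_mul_tensorOp]
    simp [Fin.sum_univ_two, XY, pX, pY]
    norm_num
  have h₂ : T2triple ghzZeroRho 0 1 3 = 0 := by
    simp only [T2triple, onQubit_eq_tensorOp, tensorOp_mul, trace_ghzZeroRho_mul_tensorOp]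
    simp [Fin.sum_univ_two, XY, pX, pY]
  exact ⟨h₁, h₂, by rw [h₁, h₂, add_zero]⟩
end
end

section
/- Cyclic averaging bound: Let h ≥ 3 and consider 2h qubits labeled 1,…,2h arranged in the cyclic hypergraph C_h with hyperedges e_j = (2j−1, 2j, 2j+1) for j = 1,…,h, where the label 2h+1 is identified with 1. Then for every 2h-qubit density matrix ρ, Σ_{j=1}^{h} 𝒯²_{e_j}(ρ) ≤ 2h. -/
open Matrix Complex ComplexOrder

noncomputable section

/-- The tensor product of a family of single-qubit operators. -/
def qubitTensor {n : ℕ} (M : Fin n → Matrix (Fin 2) (Fin 2) ℂ) :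
    Matrix (Fin n → Fin 2) (Fin n → Fin 2) ℂ :=
  Matrix.of fun a b => ∏ s, M s (a s) (b s)

lemma qubitTensor_mul {n : ℕ} (M N : Fin n → Matrix (Fin 2) (Fin 2) ℂ) :
    qubitTensor M * qubitTensor N = qubitTensor (fun s => M s * N s) := by
  ext a b
  simp only [qubitTensor, Matrix.mul_apply, Matrix.of_apply]
  rw [Finset.prod_univ_sum, Fintype.piFinset_univ]
  simp only [Finset.prod_mul_distrib]

lemma qubitTensor_one {n : ℕ} :
    qubitTensor (fun _ : Fin n => (1 : Matrix (Fin 2) (Fin 2) ℂ)) = 1 := by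
  ext a b
  simp only [qubitTensor, Matrix.of_apply, Matrix.one_apply, Finset.prod_ite_zero, funext_iff]
  simp

lemma isHermitian_qubitTensor {n : ℕ} {M : Fin n → Matrix (Fin 2) (Fin 2) ℂ}
    (hM : ∀ s, (M s).IsHermitian) : (qubitTensor M).IsHermitian := by
  ext a b
  simp only [qubitTensor, Matrix.conjTranspose_apply, Matrix.of_apply, star_prod]
  exact Finset.prod_congr rfl fun s _ => (hM s).apply _ _

lemma qubitTensor_mul_self {n : ℕ} {M : Fin n → Matrix (Fin 2) (Fin 2) ℂ}
    (hM : ∀ s, M s * M s = 1) : qubitTensor M * qubitTensor M = 1 := by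
  rw [qubitTensor_mul, funext hM, qubitTensor_one]

/-- Tensor products whose factors anticommute at exactly one site anticommute. -/
lemma qubitTensor_anticomm {n : ℕ} {M N : Fin n → Matrix (Fin 2) (Fin 2) ℂ} (t : Fin n)
    (ht : M t * N t = -(N t * M t)) (hs : ∀ s, s ≠ t → M s * N s = N s * M s) :
    qubitTensor M * qubitTensor N + qubitTensor N * qubitTensor M = 0 := by
  rw [qubitTensor_mul, qubitTensor_mul]
  ext a b
  simp only [qubitTensor, Matrix.add_apply, Matrix.of_apply, Matrix.zero_apply]
  rw [← Finset.mul_prod_erase _ _ (Finset.mem_univ t),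
    ← Finset.mul_prod_erase Finset.univ (fun s => (N s * M s) (a s) (b s)) (Finset.mem_univ t),
    ht, Finset.prod_congr rfl fun s hst => by rw [hs s (Finset.ne_of_mem_erase hst)]]
  simp

lemma onQubit_eq_qubitTensor {n : ℕ} (M : Matrix (Fin 2) (Fin 2) ℂ) (i : Fin n) :
    onQubit M i = qubitTensor (fun s => if s = i then M else 1) := by
  ext a b
  simp only [onQubit, qubitTensor, Matrix.of_apply]
  refine Finset.prod_congr rfl fun s _ => ?_
  split_ifs <;> simp_all [Matrix.one_apply]

/-- The single-qubit factors of the product of `XY k`, `XY l`, `XY p` on the qubits `i`, `j`, `m`. -/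
def xyFactors {n : ℕ} (i j m : Fin n) (k l p : Fin 2) (s : Fin n) : Matrix (Fin 2) (Fin 2) ℂ :=
  if s = i then XY k else if s = j then XY l else if s = m then XY p else 1

lemma onQubit_triple_eq {n : ℕ} {i j m : Fin n} (hij : i ≠ j) (him : i ≠ m) (hjm : j ≠ m)
    (k l p : Fin 2) :
    onQubit (XY k) i * onQubit (XY l) j * onQubit (XY p) m =
      qubitTensor (xyFactors i j m k l p) := by
  rw [onQubit_eq_qubitTensor, onQubit_eq_qubitTensor, onQubit_eq_qubitTensor, qubitTensor_mul,
    qubitTensor_mul]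
  congr 1
  funext s
  unfold xyFactors
  split_ifs <;> simp_all

lemma isHermitian_XY (k : Fin 2) : (XY k).IsHermitian := by
  fin_cases k <;> ext a b <;> fin_cases a <;> fin_cases b <;> simp [XY, pX, pY]

lemma XY_mul_self (k : Fin 2) : XY k * XY k = 1 := by
  fin_cases k <;> ext a b <;> fin_cases a <;> fin_cases b <;> simp [XY, pX, pY]

lemma XY_anticomm {k l : Fin 2} (hkl : k ≠ l) : XY k * XY l = -(XY l * XY k) := by
  fin_cases k <;> fin_cases l <;> first | exact absurd rfl hkl | skip
  all_goals ext a b; fin_cases a <;> fin_cases b <;> simp [XY, pX, pY]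

lemma isHermitian_xyFactors {n : ℕ} (i j m : Fin n) (k l p : Fin 2) (s : Fin n) :
    (xyFactors i j m k l p s).IsHermitian := by
  unfold xyFactors
  split_ifs <;> first | exact isHermitian_XY _ | exact Matrix.isHermitian_one

lemma xyFactors_mul_self {n : ℕ} (i j m : Fin n) (k l p : Fin 2) (s : Fin n) :
    xyFactors i j m k l p s * xyFactors i j m k l p s = 1 := by
  unfold xyFactors
  split_ifs <;> simp [XY_mul_self]

/-- A real linear combination of anticommuting square roots of `1` squares to a scalar. -/
lemma sum_smul_mul_self_of_anticomm {R ι : Type*} [Ring R] [Algebra ℝ R] [Fintype ι]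
    (A : ι → R) (t : ι → ℝ) (hsq : ∀ i, A i * A i = 1)
    (hanti : ∀ i j, i ≠ j → A i * A j + A j * A i = 0) :
    (∑ i, t i • A i) * ∑ i, t i • A i = (∑ i, t i ^ 2) • (1 : R) := by
  have hexp : (∑ i, t i • A i) * ∑ i, t i • A i = ∑ i, ∑ j, (t i * t j) • (A i * A j) := by
    rw [Finset.sum_mul_sum]
    simp only [smul_mul_smul_comm]
  have hswap : ∑ i, ∑ j, (t i * t j) • (A i * A j) = ∑ i, ∑ j, (t i * t j) • (A j * A i) := by
    rw [Finset.sum_comm]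
    simp only [mul_comm]
  refine smul_right_injective R (two_ne_zero (α := ℝ)) ?_
  change (2 : ℝ) • _ = (2 : ℝ) • _
  calc (2 : ℝ) • ((∑ i, t i • A i) * ∑ i, t i • A i)
      = ∑ i, ∑ j, (t i * t j) • (A i * A j + A j * A i) := by
        simp only [smul_add, Finset.sum_add_distrib]
        rw [← hswap, hexp, two_smul]
    _ = ∑ i, (t i * t i) • (A i * A i + A i * A i) := by
        refine Finset.sum_congr rfl fun i _ =>
          Finset.sum_eq_single i (fun j _ hj => ?_) (by simp)
        rw [hanti i j hj.symm, smul_zero]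
    _ = (2 : ℝ) • ((∑ i, t i ^ 2) • (1 : R)) := by
        rw [Finset.sum_smul, Finset.smul_sum]
        refine Finset.sum_congr rfl fun i _ => ?_
        rw [hsq, ← two_smul ℝ (1 : R), smul_comm, sq]

/-- For a family of Hermitian operators satisfying the Clifford relations, the squares of the
expectation values in a density matrix sum to at most `1`. -/
lemma sum_sq_expectation_le_one {n : ℕ} {ι : Type*} [Fintype ι]
    {ρ : Matrix (Fin n → Fin 2) (Fin n → Fin 2) ℂ} (hρ : IsDensityMatrix ρ)
    (A : ι → Matrix (Fin n → Fin 2) (Fin n → Fin 2) ℂ) (hA : ∀ i, (A i).IsHermitian)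
    (hsq : ∀ i, A i * A i = 1) (hanti : ∀ i j, i ≠ j → A i * A j + A j * A i = 0) :
    ∑ i, ((ρ * A i).trace.re) ^ 2 ≤ 1 := by
  set t : ι → ℝ := fun i => (ρ * A i).trace.re with ht
  set B : Matrix (Fin n → Fin 2) (Fin n → Fin 2) ℂ := ∑ i, t i • A i with hB
  have hBsq : B * B = (∑ i, t i ^ 2) • 1 := sum_smul_mul_self_of_anticomm A t hsq hanti
  have hBH : (B - 1)ᴴ = B - 1 := by
    simp only [hB, Matrix.conjTranspose_sub, Matrix.conjTranspose_sum, Matrix.conjTranspose_smul,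
      Matrix.conjTranspose_one, star_trivial]
    congr 1
    exact Finset.sum_congr rfl fun i _ => by rw [(hA i).eq]
  have htrB : (ρ * B).trace.re = ∑ i, t i ^ 2 := by
    simp only [hB, Finset.mul_sum, Matrix.trace_sum, Matrix.mul_smul, Matrix.trace_smul,
      Complex.re_sum, Complex.smul_re, smul_eq_mul, sq, ht]
  have hnonneg : 0 ≤ ((B - 1) * ρ * (B - 1)).trace.re := by
    have := (hρ.1.mul_mul_conjTranspose_same (B - 1)).trace_nonneg
    rw [hBH] at this
    exact (Complex.le_def.mp this).1
  have hexp : (B - 1) * (B - 1) = (∑ i, t i ^ 2) • 1 - (2 : ℝ) • B + 1 := by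
    rw [← hBsq, two_smul]; noncomm_ring
  rw [Matrix.mul_assoc, Matrix.trace_mul_comm, Matrix.mul_assoc, hexp] at hnonneg
  simp only [Matrix.mul_add, Matrix.mul_sub, Matrix.mul_smul, Matrix.mul_one, Matrix.trace_add,
    Matrix.trace_sub, Matrix.trace_smul, hρ.2, Complex.add_re, Complex.sub_re, Complex.smul_re,
    htrB, Complex.one_re, smul_eq_mul] at hnonneg
  linarith

/-- Two triples of qubits sharing exactly one qubit have total Bell strength at most `4`. -/
lemma T2triple_add_T2triple_le_four {n : ℕ}
    {ρ : Matrix (Fin n → Fin 2) (Fin n → Fin 2) ℂ} (hρ : IsDensityMatrix ρ) {a b c d e : Fin n}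
    (hab : a ≠ b) (hac : a ≠ c) (had : a ≠ d) (hae : a ≠ e) (hbc : b ≠ c) (hbd : b ≠ d)
    (hbe : b ≠ e) (hcd : c ≠ d) (hce : c ≠ e) (hde : d ≠ e) :
    T2triple ρ a b c + T2triple ρ c d e ≤ 4 := by
  have key (k p q : Fin 2) (hpq : p ≠ q) :
      ∑ l, ((ρ * qubitTensor (xyFactors a b c k l p)).trace.re) ^ 2 +
        ∑ l, ((ρ * qubitTensor (xyFactors c d e q k l)).trace.re) ^ 2 ≤ 1 := by
    have := sum_sq_expectation_le_one hρ
      (Sum.elim (fun l => qubitTensor (xyFactors a b c k l p))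
        (fun l => qubitTensor (xyFactors c d e q k l)))
      (by rintro (l | l) <;> exact isHermitian_qubitTensor (isHermitian_xyFactors _ _ _ _ _ _))
      (by rintro (l | l) <;> exact qubitTensor_mul_self (xyFactors_mul_self _ _ _ _ _ _))
      (by
        rintro (l | l) (l' | l') hl
        · refine qubitTensor_anticomm b ?_ fun s hs => ?_
          · simpa [xyFactors, hab.symm] using XY_anticomm (by simpa using hl)
          · simp [xyFactors, hs]
        · refine qubitTensor_anticomm c ?_ fun s hs => ?_
          · simpa [xyFactors, hac.symm, hbc.symm] using XY_anticomm hpq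
          · unfold xyFactors; split_ifs <;> simp_all
        · refine qubitTensor_anticomm c ?_ fun s hs => ?_
          · simpa [xyFactors, hac.symm, hbc.symm] using XY_anticomm hpq.symm
          · unfold xyFactors; split_ifs <;> simp_all
        · refine qubitTensor_anticomm e ?_ fun s hs => ?_
          · simpa [xyFactors, hce.symm, hde.symm] using XY_anticomm (by simpa using hl)
          · simp [xyFactors, hs])
    simpa using this
  have h₀₀ := key 0 0 1 (by decide)
  have h₀₁ := key 0 1 0 (by decide)
  have h₁₀ := key 1 0 1 (by decide)
  have h₁₁ := key 1 1 0 (by decide)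
  simp only [T2triple, onQubit_triple_eq hab hac hbc, onQubit_triple_eq hcd hce hde,
    Fin.sum_univ_two] at *
  linarith

/-- **Cyclic averaging bound.** For the cyclic hypergraph C_h on 2h qubits with hyperedges
e_j = (2j−1, 2j, 2j+1) (labels mod 2h, here 0-indexed so that e_j = (2j, 2j+1, 2j+2 mod 2h)
for j = 0,…,h−1), every 2h-qubit density matrix satisfies ∑_j 𝒯²_{e_j}(ρ) ≤ 2h. -/
theorem cyclic_averaging_bound (h : ℕ) (hh : 3 ≤ h)
    (ρ : Matrix (Fin (2 * h) → Fin 2) (Fin (2 * h) → Fin 2) ℂ) (hρ : IsDensityMatrix ρ) :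
    ∑ j : Fin h,
      T2triple ρ ⟨2 * j.val, by have := j.isLt; omega⟩
        ⟨2 * j.val + 1, by have := j.isLt; omega⟩
        ⟨(2 * j.val + 2) % (2 * h), Nat.mod_lt _ (by omega)⟩
      ≤ 2 * h := by
  have : NeZero h := ⟨by omega⟩
  set f : Fin h → ℝ := fun j =>
    T2triple ρ ⟨2 * j.val, by have := j.isLt; omega⟩
      ⟨2 * j.val + 1, by have := j.isLt; omega⟩
      ⟨(2 * j.val + 2) % (2 * h), Nat.mod_lt _ (by omega)⟩ with hf
  have hshift : ∑ j, f (j + 1) = ∑ j, f j := Equiv.sum_comp (Equiv.addRight 1) f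
  have hpair (j : Fin h) : f j + f (j + 1) ≤ 4 := by
    have hlt := j.isLt
    have hsucc : (j + 1).val = (j.val + 1) % h := by
      rw [Fin.val_add, Fin.val_one', Nat.add_mod_mod]
    have hmod (r : ℕ) : (2 * r + 2) % (2 * h) = 2 * ((r + 1) % h) := by
      rw [← Nat.mul_mod_mul_left, mul_add, mul_one]
    have hshared : (⟨(2 * j.val + 2) % (2 * h), Nat.mod_lt _ (by omega)⟩ : Fin (2 * h)) =
        ⟨2 * (j + 1).val, by have := (j + 1).isLt; omega⟩ :=
      Fin.ext ((hmod _).trans (congrArg (2 * ·) hsucc.symm))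
    have hcases (r : ℕ) (hr : r < h) :
        r + 1 < h ∧ (r + 1) % h = r + 1 ∨ r + 1 = h ∧ (r + 1) % h = 0 := by
      rcases Nat.lt_or_ge (r + 1) h with hr' | hr'
      · exact Or.inl ⟨hr', Nat.mod_eq_of_lt hr'⟩
      · obtain rfl : r + 1 = h := by omega
        exact Or.inr ⟨rfl, Nat.mod_self _⟩
    have h₁ := hcases j hlt
    have h₂ := hcases (j + 1).val (j + 1).isLt
    simp only [hf, hshared]
    apply T2triple_add_T2triple_le_four hρ <;> simp only [ne_eq, Fin.mk.injEq, hmod] <;> omega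
  have hsum := Finset.sum_le_sum fun j (_ : j ∈ Finset.univ) => hpair j
  rw [Finset.sum_add_distrib, hshift] at hsum
  simp only [Finset.sum_const, Finset.card_univ, Fintype.card_fin, nsmul_eq_mul] at hsum
  linarith
end
end
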